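/- Let L be the Lemke graph and let L□L be its Cartesian square. Then π(L□L, (v_1,v_1)) ≤ 108, π(L□L, (v_8,v_8)) ≤ 96, and π(L□L, (v_4,v_4)) ≤ 68. -/

import Mathlib

open Finset SimpleGraph

variable {V : Type*}

/-- A single pebbling move: remove two pebbles from `u` and add one pebble to a
neighbor `v`. -/
def PebblingMove (G : SimpleGraph V) (C C' : V → ℕ) : Prop :=
  ∃ u v : V, G.Adj u v ∧ 2 ≤ C u ∧
    C' u = C u - 2 ∧ C' v = C v + 1 ∧ ∀ x : V, x ≠ u → x ≠ v → C' x = C x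

/-- A configuration `C` is `r`-solvable if some finite sequence of pebbling moves
starting from `C` yields a configuration with at least one pebble on `r`. -/
def PebblingSolvable (G : SimpleGraph V) (r : V) (C : V → ℕ) : Prop :=
  ∃ C' : V → ℕ, Relation.ReflTransGen (PebblingMove G) C C' ∧ 1 ≤ C' r

/-- `piVertex G r` is the least `t` such that every configuration of size `t`
is `r`-solvable. -/
noncomputable def piVertex [Fintype V] (G : SimpleGraph V) (r : V) : ℕ :=
  sInf {t : ℕ | ∀ C : V → ℕ, (∑ v, C v) = t → PebblingSolvable G r C}

/-- The pebbling number `π(G) = max_r π(G,r)`. -/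
noncomputable def pebblingNumber [Fintype V] (G : SimpleGraph V) : ℕ :=
  Finset.univ.sup (fun r => piVertex G r)

/-- A (basic) strategy rooted at `r`: a subtree `T` of `G` containing `r` with
at least two vertices, together with a nonnegative, nonzero weight function `w`
vanishing off `T` and at `r`, with `w(v⁺) = 2·w(v)` for every vertex `v` of `T`
other than `r` and the children of `r`, where `v⁺` is the parent of `v`, i.e.
the neighbor of `v` on the path in `T` from `v` to `r`. -/
structure Strategy (G : SimpleGraph V) (r : V) where
  T : G.Subgraph
  w : V → ℚ
  root_mem : r ∈ T.verts
  two_le_ncard : 2 ≤ T.verts.ncard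
  isTree : T.coe.IsTree
  w_nonneg : ∀ v, 0 ≤ w v
  w_ne_zero : w ≠ 0
  w_outside : ∀ v, v ∉ T.verts → w v = 0
  w_root : w r = 0
  w_parent : ∀ u v : T.verts, T.coe.Adj u v → (v : V) ≠ r → ¬ T.Adj r (v : V) →
    T.coe.dist u ⟨r, root_mem⟩ < T.coe.dist v ⟨r, root_mem⟩ → w (u : V) = 2 * w (v : V)

/-- `w(C) = ∑_{v ∈ V(G)} w(v)·C(v)`. -/
noncomputable def configWeight [Fintype V] {G : SimpleGraph V} {r : V}
    (S : Strategy G r) (C : V → ℕ) : ℚ :=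
  ∑ v, S.w v * (C v : ℚ)

open Classical in
/-- `w(𝐓) = ∑_{v ∈ V(T), v ≠ r} w(v)`. -/
noncomputable def treeWeight [Fintype V] {G : SimpleGraph V} {r : V} (S : Strategy G r) : ℚ :=
  ∑ v ∈ Finset.univ.filter (fun v => v ∈ S.T.verts ∧ v ≠ r), S.w v

/-- The edges of the Lemke graph, with `v_i` represented by `i - 1 : Fin 8`. -/
def lemkeEdges : List (Fin 8 × Fin 8) :=
  [(0,1), (0,2), (1,3), (2,4), (2,5), (2,6), (3,4), (3,5), (3,6), (3,7),
   (4,7), (5,7), (6,7)]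

/-- The Lemke graph. -/
def lemkeGraph : SimpleGraph (Fin 8) :=
  SimpleGraph.fromRel (fun i j => (i, j) ∈ lemkeEdges)

/-- `BoundsUnsolvable G r w` says that every `r`-unsolvable configuration has `w`-weight at most
the total weight of `w`, i.e. that `w` satisfies the conclusion of the weight function lemma. -/
def BoundsUnsolvable [Fintype V] (G : SimpleGraph V) (r : V) (w : V → ℕ) : Prop :=
  ∀ C : V → ℕ, ¬ PebblingSolvable G r C → ∑ v, w v * C v ≤ ∑ v, w v

lemma PebblingSolvable.of_move {G : SimpleGraph V} {r : V} {C C' : V → ℕ}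
    (hC' : PebblingSolvable G r C') (h : PebblingMove G C C') : PebblingSolvable G r C := by
  obtain ⟨D, hD, hr⟩ := hC'
  exact ⟨D, .head h hD, hr⟩

/-- Moving `k` pebbles along an edge, at the cost of `2 * k` pebbles, preserves unsolvability. -/
lemma PebblingSolvable.of_moves [DecidableEq V] {G : SimpleGraph V} {r v u : V}
    (hvu : G.Adj v u) {C' : V → ℕ} (hC' : PebblingSolvable G r C') (k : ℕ) {C : V → ℕ}
    (hk : 2 * k ≤ C v) (hv : C' v = C v - 2 * k) (hu : C' u = C u + k)
    (hx : ∀ x, x ≠ v → x ≠ u → C' x = C x) : PebblingSolvable G r C := by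
  induction k generalizing C with
  | zero =>
    convert hC'
    ext x
    by_cases hxv : x = v
    · simp [hxv, hv]
    · by_cases hxu : x = u
      · simp [hxu, hu]
      · exact (hx x hxv hxu).symm
  | succ k ih =>
    have hne : v ≠ u := hvu.ne
    let C₁ : V → ℕ := Function.update (Function.update C v (C v - 2)) u (C u + 1)
    have h₁v : C₁ v = C v - 2 := by simp [C₁, hne]
    have h₁u : C₁ u = C u + 1 := by simp [C₁]
    have h₁x : ∀ x, x ≠ v → x ≠ u → C₁ x = C x := fun x h h' ↦ by simp [C₁, h, h']
    refine (ih (C := C₁) (by omega) (by omega) (by omega) fun x h h' ↦ ?_).of_move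
      ⟨v, u, hvu, by omega, h₁v, h₁u, h₁x⟩
    rw [hx x h h', h₁x x h h']

lemma PebblingSolvable.of_root_pos {G : SimpleGraph V} {r : V} {C : V → ℕ} (h : 1 ≤ C r) :
    PebblingSolvable G r C :=
  ⟨C, .refl, h⟩

lemma PebblingSolvable.of_adj_root [DecidableEq V] {G : SimpleGraph V} {r v : V} {C : V → ℕ}
    (hv : G.Adj v r) (h : 2 ≤ C v) : PebblingSolvable G r C := by
  have hC' : PebblingSolvable G r
      (Function.update (Function.update C v (C v - 2)) r (C r + 1)) := .of_root_pos (by simp)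
  refine hC'.of_moves hv 1 (by omega) (by simp [hv.ne]) (by simp) fun x h h' ↦ by simp [h, h']

namespace BoundsUnsolvable

variable [Fintype V] {G : SimpleGraph V} {r : V}

protected lemma zero : BoundsUnsolvable G r 0 := fun C _ ↦ by simp

protected lemma add {w₁ w₂ : V → ℕ} (h₁ : BoundsUnsolvable G r w₁)
    (h₂ : BoundsUnsolvable G r w₂) : BoundsUnsolvable G r (w₁ + w₂) := fun C hC ↦ by
  simpa [add_mul, sum_add_distrib] using add_le_add (h₁ C hC) (h₂ C hC)

/-- Attaching a leaf adjacent to the root, with an arbitrary weight. -/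
lemma add_single_of_adj_root [DecidableEq V] {w : V → ℕ} (h : BoundsUnsolvable G r w) {v : V}
    (hv : G.Adj v r) (a : ℕ) : BoundsUnsolvable G r (w + Pi.single v a) := by
  intro C hC
  have hCv : C v ≤ 1 := by
    by_contra! hlt
    exact hC (.of_adj_root hv hlt)
  have := h C hC
  simp only [Pi.add_apply, add_mul, sum_add_distrib, Pi.single_apply, ite_mul, zero_mul,
    sum_ite_eq', mem_univ, if_true]
  nlinarith

/-- Attaching a leaf, with at most half of the weight of its neighbor. -/
lemma add_single_of_adj [DecidableEq V] {w : V → ℕ} (h : BoundsUnsolvable G r w) {v u : V}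
    (hvu : G.Adj v u) (hw : w v = 0) {a : ℕ} (ha : 2 * a ≤ w u) :
    BoundsUnsolvable G r (w + Pi.single v a) := by
  intro C hC
  have hne : v ≠ u := hvu.ne
  set k := C v / 2 with hk
  let C' : V → ℕ := Function.update (Function.update C v (C v - 2 * k)) u (C u + k)
  have hC' : ¬ PebblingSolvable G r C' := fun hs ↦ hC <|
    hs.of_moves hvu k (by omega) (by simp [C', hne]) (by simp [C'])
      fun x h h' ↦ by simp [C', h, h']
  have hsum : ∑ x, w x * C' x = ∑ x, w x * C x + w u * k := by
    have : ∀ x, w x * C' x = w x * C x + if x = u then w u * k else 0 := by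
      intro x
      by_cases hxu : x = u
      · subst hxu; simp [C', mul_add]
      · by_cases hxv : x = v
        · subst hxv; simp [hw, hxu]
        · simp [C', hxu, hxv]
    simp [this, sum_add_distrib]
  have hle := h C' hC'
  have hCv : a * C v ≤ w u * k + a := by
    have : C v ≤ 2 * k + 1 := by omega
    nlinarith
  simp only [Pi.add_apply, add_mul, sum_add_distrib, Pi.single_apply, ite_mul, zero_mul,
    sum_ite_eq', mem_univ, if_true]
  omega

/-- Transport of a weight function along an automorphism fixing the root. -/
lemma comp_iso {w : V → ℕ} (h : BoundsUnsolvable G r w) (σ : G ≃g G) (hσ : σ r = r) :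
    BoundsUnsolvable G r (w ∘ σ) := by
  intro C hC
  have hmove : ∀ A B : V → ℕ, PebblingMove G A B → PebblingMove G (A ∘ σ) (B ∘ σ) := by
    rintro A B ⟨u, v, huv, h2, hu, hv, hx⟩
    refine ⟨σ.symm u, σ.symm v, σ.symm.map_adj_iff.2 huv, by simpa using h2, by simpa using hu,
      by simpa using hv, fun x hxu hxv ↦ hx _ ?_ ?_⟩
    · rintro rfl; simp at hxu
    · rintro rfl; simp at hxv
  have hC' : ¬ PebblingSolvable G r (C ∘ σ.symm) := by
    rintro ⟨D, hD, hr⟩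
    refine hC ⟨D ∘ σ, ?_, by simpa [hσ] using hr⟩
    have hC'' : (C ∘ σ.symm) ∘ σ = C := by ext; simp
    have := Relation.ReflTransGen.lift (· ∘ σ) hmove _ _ hD
    rwa [Function.onFun, hC''] at this
  have e₁ : ∑ v, (w ∘ σ) v * C v = ∑ v, w v * (C ∘ σ.symm) v := by
    refine (Fintype.sum_equiv σ.toEquiv _ _ fun v ↦ ?_)
    simp
  have e₂ : ∑ v, (w ∘ σ) v = ∑ v, w v := Equiv.sum_comp σ.toEquiv w
  rw [e₁, e₂]
  exact h _ hC'

/-- A weight function with at least `D` on every vertex but the root bounds `piVertex`. -/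
lemma piVertex_le {w : V → ℕ} (h : BoundsUnsolvable G r w) {D N : ℕ}
    (hD : ∀ v, v ≠ r → D ≤ w v) (hN : ∑ v, w v < D * N) : piVertex G r ≤ N := by
  refine Nat.sInf_le fun C hC ↦ ?_
  by_contra hns
  have hr : C r = 0 := by
    by_contra h0
    exact hns (.of_root_pos (by omega))
  have hle : D * N ≤ ∑ v, w v * C v := by
    rw [← hC, mul_sum]
    refine sum_le_sum fun v _ ↦ ?_
    by_cases hv : v = r
    · simp [hv, hr]
    · exact Nat.mul_le_mul_right _ (hD v hv)
  exact absurd (h C hns) (by omega)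

end BoundsUnsolvable

/-- The vertex weights of a tree strategy. The tree is a list of pairs (child, parent), in which
every vertex precedes its parent; the children of the root have weight `s`, and every other
vertex has half of the weight of its parent, rounded down. -/
def edgeListWeight (root s : ℕ) : List (ℕ × ℕ) → ℕ → ℕ
  | [], _ => 0
  | (v, u) :: l, x =>
    if x = v then if u = root then s else edgeListWeight root s l u / 2
    else edgeListWeight root s l x

lemma edgeListWeight_eq_zero {root s x : ℕ} {l : List (ℕ × ℕ)} (h : x ∉ l.map Prod.fst) :
    edgeListWeight root s l x = 0 := by
  induction l with
  | nil => rfl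
  | cons e l ih =>
    simp only [List.map_cons, List.mem_cons, not_or] at h
    simp [edgeListWeight, h.1, ih h.2]

/-- The two-digit label of a vertex of a product of two graphs on `Fin 8`. -/
def label (p : Fin 8 × Fin 8) : ℕ := 10 * p.1 + p.2

/-- The vertex with a given label. -/
def ofLabel (n : ℕ) : Fin 8 × Fin 8 := (Fin.ofNat 8 (n / 10), Fin.ofNat 8 (n % 10))

lemma label_injective : Function.Injective label := by
  rintro ⟨a, b⟩ ⟨c, d⟩ h
  simp only [label] at h
  ext <;> simp <;> omega

/-- The list of pairs of labels consists of edges of `G`, and no vertex has two parents. -/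
def IsEdgeList (G : SimpleGraph (Fin 8 × Fin 8)) (l : List (ℕ × ℕ)) : Prop :=
  (∀ e ∈ l, label (ofLabel e.1) = e.1 ∧ label (ofLabel e.2) = e.2 ∧
    G.Adj (ofLabel e.1) (ofLabel e.2)) ∧ (l.map Prod.fst).Nodup

instance (G : SimpleGraph (Fin 8 × Fin 8)) [DecidableRel G.Adj] (l : List (ℕ × ℕ)) :
    Decidable (IsEdgeList G l) :=
  inferInstanceAs (Decidable (_ ∧ _))

lemma IsEdgeList.boundsUnsolvable {G : SimpleGraph (Fin 8 × Fin 8)} {r : Fin 8 × Fin 8}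
    {l : List (ℕ × ℕ)} (h : IsEdgeList G l) (s : ℕ) :
    BoundsUnsolvable G r fun p ↦ edgeListWeight (label r) s l (label p) := by
  induction l with
  | nil => exact .zero
  | cons e l ih =>
    obtain ⟨v, u⟩ := e
    obtain ⟨hl, hnd⟩ := h
    obtain ⟨⟨hv, hu, hadj⟩, hl⟩ := List.forall_mem_cons.1 hl
    simp only [List.map_cons, List.nodup_cons] at hnd
    have ih := ih ⟨hl, hnd.2⟩
    have hw : edgeListWeight (label r) s l (label (ofLabel v)) = 0 := by
      rw [hv]
      exact edgeListWeight_eq_zero hnd.1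
    have key : (fun p ↦ edgeListWeight (label r) s ((v, u) :: l) (label p)) =
        (fun p ↦ edgeListWeight (label r) s l (label p)) + Pi.single (ofLabel v)
          (if u = label r then s else edgeListWeight (label r) s l u / 2) := by
      funext p
      by_cases hp : p = ofLabel v
      · subst hp
        rw [Pi.add_apply, hw, Pi.single_eq_same, hv]
        by_cases hur : u = label r <;> simp [edgeListWeight, hur]
      · have : label p ≠ v := fun h ↦ hp (label_injective (h.trans hv.symm))
        simp [edgeListWeight, hp, this]
    rw [key]
    split_ifs with hur
    · refine ih.add_single_of_adj_root ?_ s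
      rwa [← label_injective (hu.trans hur)]
    · refine ih.add_single_of_adj hadj hw ?_
      rw [show label (ofLabel u) = u from hu]
      omega

instance : DecidableRel lemkeGraph.Adj :=
  fun i j ↦ inferInstanceAs (Decidable (i ≠ j ∧ ((i, j) ∈ lemkeEdges ∨ (j, i) ∈ lemkeEdges)))

instance : DecidableRel (lemkeGraph.boxProd lemkeGraph).Adj :=
  fun p q ↦ inferInstanceAs (Decidable
    (lemkeGraph.Adj p.1 q.1 ∧ p.2 = q.2 ∨ lemkeGraph.Adj p.2 q.2 ∧ p.1 = q.1))

/-- The cyclic automorphism of the Lemke graph that permutes its vertices `v₅`, `v₆`, `v₇`. -/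
def lemkeRotation : lemkeGraph ≃g lemkeGraph where
  toFun := ![0, 1, 2, 3, 5, 6, 4, 7]
  invFun := ![0, 1, 2, 3, 6, 4, 5, 7]
  left_inv := by decide
  right_inv := by decide
  map_rel_iff' := by decide

/-- The rotation of the first factor of the square of the Lemke graph. -/
def lemkeSquareRotation :
    lemkeGraph.boxProd lemkeGraph ≃g lemkeGraph.boxProd lemkeGraph where
  toEquiv := lemkeRotation.toEquiv.prodCongr (Equiv.refl _)
  map_rel_iff' := by
    intro p q
    have := lemkeRotation.map_adj_iff (v := p.1) (w := q.1)
    simp_all [boxProd_adj]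

/-- The sum of a weight function over the rotations of the first factor. -/
def rotationSum (w : Fin 8 × Fin 8 → ℕ) : Fin 8 × Fin 8 → ℕ :=
  w + w ∘ lemkeSquareRotation + w ∘ lemkeSquareRotation ∘ lemkeSquareRotation

/-- The sum of a weight function over a group of 18 automorphisms of the square of the Lemke
graph, generated by the exchange of the factors and the rotation of the first factor. -/
def symmetrization (w : Fin 8 × Fin 8 → ℕ) : Fin 8 × Fin 8 → ℕ :=
  let w' := rotationSum (rotationSum w ∘ Prod.swap)
  w' + w' ∘ Prod.swap

lemma sum_rotationSum (w : Fin 8 × Fin 8 → ℕ) : ∑ p, rotationSum w p = 3 * ∑ p, w p := by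
  have h (f : Fin 8 × Fin 8 → ℕ) : ∑ p, f (lemkeSquareRotation p) = ∑ p, f p :=
    Equiv.sum_comp lemkeSquareRotation.toEquiv f
  simp only [rotationSum, Pi.add_apply, Function.comp_apply, sum_add_distrib]
  rw [h fun p ↦ w (lemkeSquareRotation p), h]
  ring

lemma sum_symmetrization (w : Fin 8 × Fin 8 → ℕ) :
    ∑ p, symmetrization w p = 18 * ∑ p, w p := by
  have h (f : Fin 8 × Fin 8 → ℕ) : ∑ p, (f ∘ Prod.swap) p = ∑ p, f p :=
    Equiv.sum_comp (Equiv.prodComm (Fin 8) (Fin 8)) f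
  simp only [symmetrization, Pi.add_apply, sum_add_distrib]
  rw [h, sum_rotationSum, h, sum_rotationSum]
  ring

namespace BoundsUnsolvable

lemma rotationSum {r : Fin 8 × Fin 8} {w : Fin 8 × Fin 8 → ℕ}
    (h : BoundsUnsolvable (lemkeGraph.boxProd lemkeGraph) r w) (hr : lemkeSquareRotation r = r) :
    BoundsUnsolvable (lemkeGraph.boxProd lemkeGraph) r (rotationSum w) :=
  (h.add (h.comp_iso _ hr)).add ((h.comp_iso _ hr).comp_iso _ hr)

lemma symmetrization {r : Fin 8 × Fin 8} {w : Fin 8 × Fin 8 → ℕ}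
    (h : BoundsUnsolvable (lemkeGraph.boxProd lemkeGraph) r w)
    (hr : lemkeSquareRotation r = r) (hr' : r.swap = r) :
    BoundsUnsolvable (lemkeGraph.boxProd lemkeGraph) r (symmetrization w) := by
  have h' := ((h.rotationSum hr).comp_iso (boxProdComm lemkeGraph lemkeGraph) hr').rotationSum hr
  exact h'.add (h'.comp_iso (boxProdComm lemkeGraph lemkeGraph) hr')

end BoundsUnsolvable

/-- The sum of the weights of a list of tree strategies, each given by the weight of the children
of the root and the list of edges. -/
def certificateWeight (root : ℕ) (c : List (ℕ × List (ℕ × ℕ))) (p : Fin 8 × Fin 8) : ℕ :=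
  (c.map fun t ↦ edgeListWeight root t.1 t.2 (label p)).sum

lemma boundsUnsolvable_certificateWeight {G : SimpleGraph (Fin 8 × Fin 8)} {r : Fin 8 × Fin 8}
    {c : List (ℕ × List (ℕ × ℕ))} (h : ∀ t ∈ c, IsEdgeList G t.2) :
    BoundsUnsolvable G r (certificateWeight (label r) c) := by
  induction c with
  | nil => exact .zero
  | cons t c ih =>
    obtain ⟨ht, hc⟩ := List.forall_mem_cons.1 h
    exact (ht.boundsUnsolvable t.1).add (ih hc)

/-- Tree strategies whose symmetrized total weight is at least `18 * D` at every vertex but the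
root, and less than `18 * D * N` in total, certify that `piVertex` is at most `N`. -/
lemma piVertex_le_of_certificate {r : Fin 8 × Fin 8} (c : List (ℕ × List (ℕ × ℕ))) (D : ℕ) {N : ℕ}
    (hr : lemkeSquareRotation r = r ∧ r.swap = r)
    (hc : ∀ t ∈ c, IsEdgeList (lemkeGraph.boxProd lemkeGraph) t.2)
    (hD : ∀ p, p ≠ r → 18 * D ≤ symmetrization (certificateWeight (label r) c) p)
    (hN : ∑ p, certificateWeight (label r) c p < D * N) :
    piVertex (lemkeGraph.boxProd lemkeGraph) r ≤ N := by
  refine ((boundsUnsolvable_certificateWeight hc).symmetrization hr.1 hr.2).piVertex_le hD ?_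
  rw [sum_symmetrization]
  linarith

/-- Tree strategies for the root `(v₁, v₁)`; the label `ij` stands for `(i, j)`. -/
def strategies₁ : List (ℕ × List (ℕ × ℕ)) :=
  [(608, [(16, 17), (77, 57), (15, 12), (14, 12), (17, 7), (57, 55), (12, 32), (66, 63),
     (65, 63), (64, 63), (46, 43), (45, 43), (44, 43), (7, 27), (72, 52), (56, 52), (55, 52),
     (54, 52), (32, 52), (71, 41), (63, 23), (43, 23), (27, 23), (70, 50), (52, 50), (61, 21),
     (51, 21), (41, 21), (23, 21), (50, 20), (21, 20), (20, 0)]),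
   (105, [(77, 67), (76, 56), (75, 73), (74, 73), (37, 47), (67, 63), (57, 53), (56, 53),
     (73, 43), (47, 43), (63, 61), (53, 51), (43, 41), (16, 13), (15, 13), (14, 13), (61, 21),
     (51, 21), (41, 21), (13, 3), (7, 3), (21, 1), (3, 1), (1, 0)]),
   (449, [(77, 73), (76, 73), (75, 73), (74, 73), (67, 37), (57, 37), (47, 37), (73, 71),
     (37, 17), (71, 31), (17, 13), (31, 11), (13, 11), (11, 1), (1, 0)]),
   (765, [(77, 57), (76, 36), (75, 35), (74, 34), (67, 63), (57, 53), (47, 43), (73, 33),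
     (37, 33), (36, 33), (35, 33), (34, 33), (63, 23), (53, 23), (43, 23), (33, 13), (23, 3),
     (13, 3), (3, 1), (1, 0)]),
   (88, [(77, 37), (73, 33), (37, 33), (33, 13), (13, 3), (3, 1), (1, 0)]),
   (335, [(77, 74), (73, 76), (37, 47), (67, 64), (75, 55), (57, 55), (74, 54), (76, 46),
     (47, 46), (66, 62), (65, 62), (64, 62), (56, 52), (55, 52), (54, 52), (46, 42), (45, 42),
     (44, 42), (62, 22), (52, 22), (42, 22), (22, 20), (20, 0)]),
   (221, [(73, 76), (77, 74), (37, 47), (76, 72), (75, 72), (74, 72), (67, 27), (57, 27),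
     (47, 27), (72, 62), (27, 26), (62, 22), (26, 22), (22, 20), (20, 0)]),
   (745, [(77, 57), (57, 55), (55, 52), (52, 50), (50, 20), (20, 0)])]

lemma piVertex_le₁ : piVertex (lemkeGraph.boxProd lemkeGraph) (0, 0) ≤ 108 := by
  refine piVertex_le_of_certificate strategies₁ 100 ?_ ?_ ?_ ?_ <;> decide +kernel

/-- Tree strategies for the root `(v₈, v₈)`; the label `ij` stands for `(i, j)`. -/
def strategies₈ : List (ℕ × List (ℕ × ℕ)) :=
  [(2379, [(0, 10), (10, 11), (1, 11), (11, 31), (31, 33), (33, 37), (37, 77)]),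
   (1595, [(0, 20), (20, 50), (50, 52), (52, 72), (72, 76), (76, 77)]),
   (3363, [(0, 2), (2, 22), (22, 62), (62, 65), (65, 67), (67, 77)]),
   (3366, [(11, 10), (0, 10), (1, 21), (6, 3), (4, 3), (20, 40), (10, 12), (2, 12), (21, 23),
     (3, 5), (60, 70), (50, 70), (40, 70), (30, 70), (12, 32), (23, 25), (5, 25), (70, 72),
     (32, 72), (25, 45), (72, 75), (45, 75), (75, 77)]),
   (1186, [(20, 50), (0, 10), (22, 2), (60, 61), (50, 51), (40, 41), (10, 11), (1, 11), (2, 4),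
     (61, 31), (51, 31), (41, 31), (11, 31), (6, 16), (5, 15), (4, 14), (31, 33), (16, 17),
     (15, 17), (14, 17), (33, 37), (17, 37), (37, 77)]),
   (704, [(20, 0), (61, 31), (51, 31), (41, 31), (0, 2), (31, 30), (2, 6), (30, 32), (6, 16),
     (3, 13), (32, 34), (14, 34), (16, 17), (15, 17), (13, 17), (34, 37), (17, 37), (37, 77)]),
   (305, [(0, 10), (62, 60), (52, 50), (42, 40), (10, 30), (6, 26), (5, 3), (4, 3), (1, 3),
     (60, 70), (50, 70), (40, 70), (30, 70), (26, 23), (25, 23), (24, 23), (3, 23), (70, 71),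
     (23, 53), (71, 73), (63, 73), (53, 73), (43, 73), (73, 77)]),
   (2327, [(0, 1), (12, 16), (1, 21), (16, 36), (21, 51), (36, 56), (51, 53), (56, 57), (53, 57),
     (57, 77)]),
   (876, [(1, 3), (53, 23), (43, 23), (3, 23), (23, 25), (0, 20), (10, 30), (25, 22), (24, 22),
     (20, 22), (2, 22), (30, 70), (22, 62), (70, 72), (62, 72), (52, 72), (42, 72), (14, 34),
     (72, 74), (34, 74), (74, 77)])]

lemma piVertex_le₈ : piVertex (lemkeGraph.boxProd lemkeGraph) (7, 7) ≤ 96 := by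
  refine piVertex_le_of_certificate strategies₈ 500 ?_ ?_ ?_ ?_ <;> decide +kernel

/-- Tree strategies for the root `(v₄, v₄)`; the label `ij` stands for `(i, j)`. -/
def strategies₄ : List (ℕ × List (ℕ × ℕ)) :=
  [(1798, [(20, 0), (60, 70), (50, 70), (40, 70), (22, 2), (0, 2), (70, 72), (2, 5), (72, 74),
     (64, 74), (54, 74), (44, 74), (6, 7), (5, 7), (4, 7), (74, 77), (7, 17), (77, 37), (17, 37),
     (37, 33)]),
   (1857, [(72, 62), (62, 22), (52, 22), (42, 22), (22, 26), (20, 0), (2, 0), (27, 23), (26, 23),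
     (25, 23), (24, 23), (0, 1), (23, 3), (1, 3), (3, 13), (13, 33)]),
   (1594, [(44, 74), (75, 65), (76, 56), (74, 54), (71, 70), (66, 67), (65, 67), (56, 57),
     (55, 57), (54, 57), (70, 72), (67, 27), (57, 27), (72, 32), (22, 2), (27, 7), (32, 12),
     (2, 12), (0, 10), (21, 1), (7, 17), (12, 15), (10, 11), (1, 11), (17, 13), (15, 13),
     (11, 13), (13, 33)]),
   (341, [(0, 2), (20, 22), (2, 22), (67, 27), (57, 27), (7, 27), (22, 24), (62, 72), (52, 72),
     (42, 72), (27, 47), (26, 23), (25, 23), (24, 23), (72, 76), (70, 71), (47, 43), (23, 43),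
     (76, 73), (75, 73), (74, 73), (71, 73), (43, 73), (73, 33)]),
   (398, [(52, 56), (62, 64), (2, 4), (60, 20), (50, 20), (66, 26), (56, 26), (6, 26), (65, 25),
     (55, 25), (5, 25), (64, 24), (54, 24), (4, 24), (20, 40), (26, 46), (25, 45), (42, 44),
     (24, 44), (40, 41), (46, 43), (45, 43), (44, 43), (41, 43), (43, 33)]),
   (139, [(22, 26), (26, 66), (66, 36), (36, 33)]),
   (1209, [(52, 32), (42, 32), (12, 32), (50, 70), (40, 20), (0, 20), (72, 62), (32, 62),
     (70, 60), (20, 60), (7, 27), (6, 26), (5, 25), (4, 24), (62, 64), (60, 61), (27, 23),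
     (26, 23), (25, 23), (24, 23), (21, 23), (64, 63), (61, 63), (23, 63), (63, 33)]),
   (535, [(20, 22), (22, 62), (2, 12), (62, 32), (12, 32), (32, 35), (35, 33)]),
   (2729, [(21, 20), (74, 64), (75, 65), (20, 60), (5, 2), (4, 2), (0, 2), (64, 67), (65, 62),
     (60, 62), (55, 57), (54, 57), (50, 52), (22, 52), (44, 47), (45, 42), (40, 42), (2, 6),
     (67, 66), (62, 66), (57, 56), (52, 56), (47, 46), (42, 46), (12, 16), (6, 16), (76, 36),
     (66, 36), (56, 36), (46, 36), (16, 36), (36, 33)]),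
   (1582, [(75, 72), (72, 70), (70, 40), (60, 20), (50, 20), (40, 20), (67, 27), (57, 27),
     (47, 27), (22, 2), (61, 21), (51, 21), (41, 21), (20, 21), (27, 7), (2, 4), (21, 1), (0, 1),
     (6, 16), (5, 15), (7, 3), (4, 3), (1, 3), (16, 13), (15, 13), (14, 13), (3, 13), (13, 33)]),
   (425, [(71, 41), (41, 40), (20, 40), (26, 22), (25, 22), (61, 60), (51, 50), (27, 24),
     (23, 24), (1, 3), (6, 2), (5, 2), (40, 42), (22, 42), (60, 30), (50, 30), (10, 30),
     (16, 17), (15, 17), (24, 4), (3, 4), (2, 4), (77, 74), (72, 74), (62, 32), (52, 32),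
     (42, 32), (30, 32), (17, 14), (4, 14), (74, 34), (32, 34), (14, 34), (34, 33)]),
   (549, [(25, 22), (24, 22), (26, 6), (22, 20), (2, 0), (7, 3), (6, 3), (5, 3), (4, 3),
     (62, 60), (20, 60), (52, 50), (42, 40), (0, 10), (3, 1), (70, 30), (60, 30), (50, 30),
     (40, 30), (10, 11), (1, 11), (30, 31), (11, 31), (31, 33)]),
   (806, [(20, 22), (2, 22), (27, 25), (22, 25), (72, 75), (25, 55), (75, 35), (55, 35),
     (35, 33)])]

lemma piVertex_le₄ : piVertex (lemkeGraph.boxProd lemkeGraph) (3, 3) ≤ 68 := by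
  refine piVertex_le_of_certificate strategies₄ 1000 ?_ ?_ ?_ ?_ <;> decide +kernel

/-- Upper bounds on the pebbling number of the Cartesian square `L□L` of the
Lemke graph at the roots `(v_1,v_1)`, `(v_8,v_8)`, and `(v_4,v_4)`. -/
theorem lemke_square_piVertex_le :
    piVertex (lemkeGraph.boxProd lemkeGraph) (0, 0) ≤ 108 ∧
    piVertex (lemkeGraph.boxProd lemkeGraph) (7, 7) ≤ 96 ∧
    piVertex (lemkeGraph.boxProd lemkeGraph) (3, 3) ≤ 68 := by
  exact ⟨piVertex_le₁, piVertex_le₈, piVertex_le₄⟩
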